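/- For positive integers N, m, l with 1 ≤ l ≤ N, the following transformation holds: ∑_{e=0}^{l−1} (−N)_e (1−N/2)_e (m)_e (−m−N)_e (1/2)_e / ( (−N/2)_e (1−m−N)_e (1+m)_e (1/2−N)_e e! ) = [ (−N+1)_{l−1} (−l+1/2)_{l−1} / ( (−N+1/2)_{l−1} (−l+1)_{l−1} ) ] · ∑_{k=0}^{l−1} (1)_k (1/2)_k (l−N)_k (1−l)_k / ( k! (1+m)_k (1−m−N)_k (3/2)_k ), provided all denominators are nonzero (e.g., when m ≥ 1 and l ≤ N). -/

import Mathlib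

/-- The shifted factorial (Pochhammer symbol) `(x)_k = x(x+1)⋯(x+k-1)`. -/
def poch (x : ℚ) (k : ℕ) : ℚ := ∏ t ∈ Finset.range k, (x + t)

theorem poch_zero (x : ℚ) : poch x 0 = 1 := by simp [poch]

theorem poch_succ (x : ℚ) (k : ℕ) : poch x (k + 1) = poch x k * (x + k) :=
  Finset.prod_range_succ _ _

theorem poch_succ_left (x : ℚ) (k : ℕ) : poch x (k + 1) = x * poch (x + 1) k := by
  simp only [poch, Finset.prod_range_succ', Nat.cast_zero, add_zero, Nat.cast_add, Nat.cast_one]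
  rw [mul_comm]
  congr 1
  exact Finset.prod_congr rfl fun t _ => by ring

theorem poch_add_one_mul (x : ℚ) (k : ℕ) : x * poch (x + 1) k = poch x k * (x + k) := by
  rw [← poch_succ_left, poch_succ]

theorem poch_ne_zero {x : ℚ} {k : ℕ} (h : ∀ t < k, x + t ≠ 0) : poch x k ≠ 0 :=
  Finset.prod_ne_zero_iff.mpr fun t ht => h t (Finset.mem_range.mp ht)

theorem poch_one (k : ℕ) : poch 1 k = k.factorial := by
  induction k with
  | zero => simp [poch_zero]
  | succ k ih => rw [poch_succ, ih, Nat.factorial_succ]; push_cast; ring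

theorem poch_neg_cast_succ (l : ℕ) : poch (-(l : ℚ)) (l + 1) = 0 := by
  simp [poch_succ]

theorem poch_reflect (x : ℚ) (n : ℕ) : poch x n = (-1) ^ n * poch (1 - n - x) n := by
  have hpow : (-1 : ℚ) ^ n = ∏ _t ∈ Finset.range n, (-1 : ℚ) := by simp
  unfold poch
  rw [← Finset.prod_range_reflect, hpow, ← Finset.prod_mul_distrib]
  refine Finset.prod_congr rfl fun t ht => ?_
  have h : t + 1 ≤ n := Finset.mem_range.mp ht
  rw [Nat.sub_sub, Nat.cast_sub (by omega)]
  push_cast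
  ring

theorem poch_half_div (k : ℕ) : poch (1 / 2) k / poch (3 / 2) k = 1 / (2 * k + 1) := by
  have h := poch_add_one_mul (1 / 2) k
  norm_num at h
  have h3 : poch (3 / 2) k ≠ 0 := poch_ne_zero fun t _ => by positivity
  have hk : (2 * k + 1 : ℚ) ≠ 0 := by positivity
  norm_num
  field_simp
  linarith

/-- The prefactor of the transformation at `l = n + 1`, with the reflected factors cancelled. -/
def whipplePrefactor (N : ℚ) (n : ℕ) : ℚ :=
  poch (1 - N) n * poch (3 / 2) n / (poch (1 / 2 - N) n * n.factorial)

theorem whipplePrefactor_eq (N : ℚ) (n : ℕ) :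
    poch (-N + 1) n * poch (-((n + 1 : ℕ) : ℚ) + 1 / 2) n /
      (poch (-N + 1 / 2) n * poch (-((n + 1 : ℕ) : ℚ) + 1) n) = whipplePrefactor N n := by
  rw [poch_reflect (-((n + 1 : ℕ) : ℚ) + 1 / 2), poch_reflect (-((n + 1 : ℕ) : ℚ) + 1)]
  have h1 : (1 - n - (-((n + 1 : ℕ) : ℚ) + 1 / 2) : ℚ) = 3 / 2 := by push_cast; ring
  have h2 : (1 - n - (-((n + 1 : ℕ) : ℚ) + 1) : ℚ) = 1 := by push_cast; ring
  rw [h1, h2, poch_one, whipplePrefactor, neg_add_eq_sub, neg_add_eq_sub,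
    mul_left_comm, mul_left_comm (poch (1 / 2 - N) n),
    mul_div_mul_left _ _ (pow_ne_zero n (by norm_num : (-1 : ℚ) ≠ 0))]

/-- The summand of the right-hand side, with the factors `(1)_k / k!` cancelled and
`(1/2)_k / (3/2)_k` simplified. -/
def whippleTerm (N m l : ℚ) (k : ℕ) : ℚ :=
  poch (l - N) k * poch (1 - l) k / ((2 * k + 1) * poch (1 + m) k * poch (1 - m - N) k)

theorem whippleTerm_eq (N m l : ℚ) (k : ℕ) :
    poch 1 k * poch (1 / 2) k * poch (l - N) k * poch (1 - l) k /
      ((k.factorial : ℚ) * poch (1 + m) k * poch (1 - m - N) k * poch (3 / 2) k) =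
      whippleTerm N m l k := by
  have hk : (k.factorial : ℚ) ≠ 0 := by positivity
  calc _ = ((k.factorial : ℚ) / k.factorial) * (poch (1 / 2) k / poch (3 / 2) k) *
        (poch (l - N) k * poch (1 - l) k / (poch (1 + m) k * poch (1 - m - N) k)) := by
        rw [poch_one, div_mul_div_comm, div_mul_div_comm]; congr 1 <;> ring
    _ = _ := by
        rw [div_self hk, poch_half_div, one_mul, div_mul_div_comm, one_mul, whippleTerm,
          mul_assoc (2 * (k : ℚ) + 1)]

/-- The antidifference certificate for the difference in `l` of the right-hand summands. -/
def whippleCert (N m l : ℚ) (k : ℕ) : ℚ :=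
  (N - 2 * l) / (-l * (2 * l - 2 * N - 1) * (m + l) * (m + N - l)) *
    (poch (-l) k * poch (l - N) k * (m + k) * (k - m - N) /
      (poch (1 + m) k * poch (1 - m - N) k))

theorem whippleTerm_telescope {N m l : ℚ} {k : ℕ} (hl : l ≠ 0) (hlN : l - N ≠ 0)
    (h2 : 2 * l - 2 * N - 1 ≠ 0) (h3 : m + l ≠ 0) (h4 : m + N - l ≠ 0)
    (h5 : poch (1 + m) (k + 1) ≠ 0) (h6 : poch (1 - m - N) (k + 1) ≠ 0) :
    (l - N) * (2 * l + 1) / ((2 * l - 2 * N - 1) * l) * whippleTerm N m (l + 1) k -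
      whippleTerm N m l k = whippleCert N m l (k + 1) - whippleCert N m l k := by
  have e1 : poch (l + 1 - N) k = poch (l - N) k * (l - N + k) / (l - N) := by
    rw [eq_div_iff hlN, ← poch_add_one_mul, mul_comm]; ring_nf
  have e2 : poch (1 - l) k = poch (-l) k * (-l + k) / (-l) := by
    rw [eq_div_iff (neg_ne_zero.mpr hl), ← poch_add_one_mul, mul_comm]; ring_nf
  have e3 : poch (1 - (l + 1)) k = poch (-l) k := by ring_nf
  rw [poch_succ] at h5 h6
  obtain ⟨h5, h5'⟩ := mul_ne_zero_iff.mp h5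
  obtain ⟨h6, h6'⟩ := mul_ne_zero_iff.mp h6
  have hk : (2 * k + 1 : ℚ) ≠ 0 := by positivity
  simp only [whippleTerm, whippleCert, e1, e2, e3, poch_succ]
  push_cast
  generalize poch (1 + m) k = D at *
  generalize poch (1 - m - N) k = E at *
  generalize poch (-l) k = A at *
  generalize poch (l - N) k = B at *
  generalize (k : ℚ) = x at *
  have e4 : A * (-l + x) * (B * (l - N + x)) * (m + (x + 1)) * (x + 1 - m - N) /
      (D * (1 + m + x) * (E * (1 - m - N + x))) =
      A * B * (x - l) * (l - N + x) / (D * E) := by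
    rw [div_eq_div_iff (by simp_all) (by simp_all)]; ring
  rw [e4]
  obtain ⟨y, hy⟩ : ∃ y, y = 2 * l - 2 * N - 1 := ⟨_, rfl⟩
  rw [← hy] at h2 ⊢
  field_simp
  rw [hy]
  ring

theorem whipplePrefactor_succ {N : ℚ} {n : ℕ} (h : poch (1 / 2 - N) (n + 1) ≠ 0) :
    whipplePrefactor N (n + 1) = whipplePrefactor N n *
      (((n + 1 : ℚ) - N) * (2 * (n + 1) + 1) / ((2 * (n + 1) - 2 * N - 1) * (n + 1))) := by
  rw [poch_succ] at h
  obtain ⟨h1, h2⟩ := mul_ne_zero_iff.mp h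
  have h3 : (2 * (n + 1) - 2 * N - 1 : ℚ) ≠ 0 := fun h => h2 (by linarith)
  have hn : (n + 1 : ℚ) ≠ 0 := by positivity
  have hf : (n.factorial : ℚ) ≠ 0 := by positivity
  simp only [whipplePrefactor, poch_succ, Nat.factorial_succ]
  push_cast
  have e : (1 / 2 - N + n : ℚ) = (2 * (n + 1) - 2 * N - 1) / 2 := by ring
  rw [e]
  generalize (2 * (n + 1) - 2 * N - 1 : ℚ) = y at *
  field_simp
  ring

/-- The left-hand summand equals minus the boundary value of the certificate. -/
theorem whipple_summand_eq {N m : ℚ} {n : ℕ} (hN : N ≠ 0)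
    (h1 : poch (-N / 2) (n + 1) ≠ 0) (h2 : poch (1 - m - N) (n + 1) ≠ 0)
    (h3 : poch (1 + m) (n + 1) ≠ 0) (h4 : poch (1 / 2 - N) (n + 1) ≠ 0) :
    poch (-N) (n + 1) * poch (1 - N / 2) (n + 1) * poch m (n + 1) * poch (-m - N) (n + 1) *
        poch (1 / 2) (n + 1) /
      (poch (-N / 2) (n + 1) * poch (1 - m - N) (n + 1) * poch (1 + m) (n + 1) *
        poch (1 / 2 - N) (n + 1) * ((n + 1).factorial : ℚ)) =
      -(whipplePrefactor N n * whippleCert N m (n + 1) 0) := by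
  have hN2 : -N / 2 ≠ 0 := by simpa using hN
  have hf : (n.factorial : ℚ) ≠ 0 := by positivity
  have hn : (n + 1 : ℚ) ≠ 0 := by positivity
  have a1 : poch (1 - N / 2) (n + 1) / poch (-N / 2) (n + 1) = (N - 2 * (n + 1)) / N := by
    have h := poch_add_one_mul (-N / 2) (n + 1)
    rw [show -N / 2 + 1 = 1 - N / 2 by ring] at h
    rw [div_eq_div_iff h1 hN]
    push_cast at h
    linarith
  have a2 : poch m (n + 1) / poch (1 + m) (n + 1) = m / (m + (n + 1)) := by
    have h := poch_add_one_mul m (n + 1)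
    have h' := h3
    rw [poch_succ] at h'
    have := (mul_ne_zero_iff.mp h').2
    rw [add_comm m 1] at h
    push_cast at h
    rw [div_eq_div_iff h3 (fun h => this (by linarith)), h]
  have a3 : poch (-m - N) (n + 1) / poch (1 - m - N) (n + 1) = (m + N) / (m + N - (n + 1)) := by
    have h := poch_add_one_mul (-m - N) (n + 1)
    have h' := h2
    rw [poch_succ] at h'
    have := (mul_ne_zero_iff.mp h').2
    rw [show -m - N + 1 = 1 - m - N by ring] at h
    push_cast at h
    rw [div_eq_div_iff h2 (fun h => this (by linarith))]
    linarith
  have a4 : poch (-N) (n + 1) * poch (1 / 2) (n + 1) /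
      (poch (1 / 2 - N) (n + 1) * ((n + 1).factorial : ℚ)) =
      whipplePrefactor N n * (-N / ((2 * (n + 1) - 2 * N - 1) * (n + 1))) := by
    rw [poch_succ] at h4
    obtain ⟨h4, h5⟩ := mul_ne_zero_iff.mp h4
    have h6 : (2 * (n + 1) - 2 * N - 1 : ℚ) ≠ 0 := fun h => h5 (by linarith)
    rw [poch_succ_left (-N), poch_succ_left (1 / 2), poch_succ, Nat.factorial_succ,
      show -N + 1 = 1 - N by ring, show (1 / 2 + 1 : ℚ) = 3 / 2 by norm_num,
      show (1 / 2 - N + n : ℚ) = (2 * (n + 1) - 2 * N - 1) / 2 by ring, whipplePrefactor]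
    push_cast
    generalize (2 * (n + 1) - 2 * N - 1 : ℚ) = y at *
    field_simp
  calc _ = (poch (-N) (n + 1) * poch (1 / 2) (n + 1) /
      (poch (1 / 2 - N) (n + 1) * ((n + 1).factorial : ℚ))) *
      (poch (1 - N / 2) (n + 1) / poch (-N / 2) (n + 1)) *
      (poch m (n + 1) / poch (1 + m) (n + 1)) *
      (poch (-m - N) (n + 1) / poch (1 - m - N) (n + 1)) := by
        simp only [div_mul_div_comm]; congr 1 <;> ring
    _ = _ := by
        rw [a1, a2, a3, a4]
        have e : (-N / ((2 * (n + 1) - 2 * N - 1) * (n + 1))) * ((N - 2 * (n + 1)) / N) =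
            (N - 2 * (n + 1)) / (-(n + 1) * (2 * (n + 1) - 2 * N - 1)) := by
          rw [div_mul_div_comm, show (2 * (n + 1) - 2 * N - 1) * (n + 1) * N =
              (-N) * (-(n + 1) * (2 * (n + 1) - 2 * N - 1)) by ring,
            mul_div_mul_left _ _ (neg_ne_zero.mpr hN)]
        rw [mul_assoc (whipplePrefactor N n), e]
        simp only [whippleCert, poch_zero, Nat.cast_zero]
        rw [mul_assoc, mul_assoc, div_mul_div_comm, div_mul_div_comm, ← mul_neg]
        congr 1
        rw [mul_one, div_one, div_mul_eq_mul_div, ← neg_div]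
        congr 1 <;> ring

theorem whipple_rhs_succ {N m : ℚ} {n : ℕ} (hN : (n + 1 : ℚ) < N) (hm : 0 < m)
    (h2 : ∀ k ≤ n + 2, poch (1 - m - N) k ≠ 0) (h4 : poch (1 / 2 - N) (n + 1) ≠ 0) :
    whipplePrefactor N (n + 1) * ∑ k ∈ Finset.range (n + 2), whippleTerm N m (n + 1 + 1) k -
      whipplePrefactor N n * ∑ k ∈ Finset.range (n + 1), whippleTerm N m (n + 1) k =
      -(whipplePrefactor N n * whippleCert N m (n + 1) 0) := by
  have hl : (0 : ℚ) < n + 1 := by positivity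
  have hlast : whippleTerm N m (n + 1) (n + 1) = 0 := by
    have := poch_neg_cast_succ n
    rw [whippleTerm, show (1 - (n + 1) : ℚ) = -n by ring, this]
    simp
  have hend : whippleCert N m (n + 1) (n + 2) = 0 := by
    have := poch_neg_cast_succ (n + 1)
    push_cast at this
    rw [whippleCert, this]
    simp
  have hsum : ∑ k ∈ Finset.range (n + 1), whippleTerm N m (n + 1) k =
      ∑ k ∈ Finset.range (n + 2), whippleTerm N m (n + 1) k := by
    rw [Finset.sum_range_succ _ (n + 1), hlast, add_zero]
  rw [hsum, whipplePrefactor_succ h4, mul_assoc, ← mul_sub, Finset.mul_sum,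
    ← Finset.sum_sub_distrib, ← mul_neg]
  congr 1
  rw [Finset.sum_congr rfl fun k hk => whippleTerm_telescope hl.ne' (by linarith) (by linarith)
    (by positivity) (by linarith) (poch_ne_zero fun t _ => by positivity)
    (h2 _ (by have := Finset.mem_range.mp hk; omega)), Finset.sum_range_sub, hend, zero_sub]

/-- The limiting case of Whipple's transformation: for positive integers
`N, m, l` with `l ≤ N`, provided all denominators are nonzero,
`∑_{e=0}^{l−1} (−N)_e(1−N/2)_e(m)_e(−m−N)_e(1/2)_e /((−N/2)_e(1−m−N)_e(1+m)_e(1/2−N)_e e!)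
 = (−N+1)_{l−1}(−l+1/2)_{l−1}/((−N+1/2)_{l−1}(−l+1)_{l−1})
   · ∑_{k=0}^{l−1} (1)_k(1/2)_k(l−N)_k(1−l)_k/(k!(1+m)_k(1−m−N)_k(3/2)_k)`. -/
theorem whipple_limit_transformation (N m l : ℕ)
    (hN : 0 < N) (hm : 0 < m) (hl : 1 ≤ l) (hlN : l ≤ N)
    (hden : ∀ e < l, poch (-(N : ℚ) / 2) e ≠ 0 ∧ poch (1 - (m : ℚ) - N) e ≠ 0 ∧
      poch (1 + (m : ℚ)) e ≠ 0 ∧ poch (1 / 2 - (N : ℚ)) e ≠ 0) :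
    ∑ e ∈ Finset.range l,
        poch (-(N : ℚ)) e * poch (1 - (N : ℚ) / 2) e * poch (m : ℚ) e *
            poch (-(m : ℚ) - N) e * poch (1 / 2) e /
          (poch (-(N : ℚ) / 2) e * poch (1 - (m : ℚ) - N) e * poch (1 + (m : ℚ)) e *
            poch (1 / 2 - (N : ℚ)) e * (e.factorial : ℚ)) =
      poch (-(N : ℚ) + 1) (l - 1) * poch (-(l : ℚ) + 1 / 2) (l - 1) /
          (poch (-(N : ℚ) + 1 / 2) (l - 1) * poch (-(l : ℚ) + 1) (l - 1)) *
        ∑ k ∈ Finset.range l,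
          poch 1 k * poch (1 / 2) k * poch ((l : ℚ) - N) k * poch (1 - (l : ℚ)) k /
            ((k.factorial : ℚ) * poch (1 + (m : ℚ)) k * poch (1 - (m : ℚ) - N) k *
              poch (3 / 2) k) := by
  simp only [whippleTerm_eq]
  obtain ⟨n, rfl⟩ := Nat.exists_eq_succ_of_ne_zero (by omega : l ≠ 0)
  simp only [Nat.succ_eq_add_one, Nat.add_sub_cancel, whipplePrefactor_eq]
  have hN' : (N : ℚ) ≠ 0 := by positivity
  have hm' : (0 : ℚ) < m := by positivity
  clear hl
  induction n with
  | zero => simp [whipplePrefactor, whippleTerm, poch_zero]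
  | succ n ih =>
    obtain ⟨h1, h2, h3, h4⟩ := hden (n + 1) (by omega)
    have hlt : (n + 1 : ℚ) < N := by exact_mod_cast (by omega : n + 1 < N)
    have h5 : ∀ k ≤ n + 2, poch (1 - (m : ℚ) - N) k ≠ 0 := fun k hk => poch_ne_zero fun t ht h => by
      have ht' : (t : ℚ) + 1 ≤ n + 2 := by exact_mod_cast (by omega : t + 1 ≤ n + 2)
      have hm1 : (1 : ℚ) ≤ m := by exact_mod_cast hm
      linarith
    rw [Finset.sum_range_succ, ih (by omega) fun e he => hden e (by omega),
      whipple_summand_eq hN' h1 h2 h3 h4, ← whipple_rhs_succ hlt hm' h5 h4]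
    push_cast
    ring
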